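/- Let C₂ = ℤ/2ℤ act on ℤ² = ℤ × ℤ by letting the nontrivial element act by negation x ↦ −x. Then the abelianization of the semidirect product ℤ² ⋊ C₂ is isomorphic to (ℤ/2ℤ)³. -/

import Mathlib

/-- The action of `C₂ = ℤ/2ℤ` on the abelian group `ℤ × ℤ` in which the nontrivial
element acts by negation `x ↦ -x` (written multiplicatively as inversion). -/
def negPhi : Multiplicative (ZMod 2) →* MulAut (Multiplicative (ℤ × ℤ)) where
  toFun g := if Multiplicative.toAdd g = 0 then 1
    else MulEquiv.inv (Multiplicative (ℤ × ℤ))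
  map_one' := by simp
  map_mul' := by
    intro a b
    have h : ∀ x : ZMod 2, x = 0 ∨ x = 1 := by decide
    have h11 : (1 + 1 : ZMod 2) = 0 := by decide
    have hinv : (MulEquiv.inv (Multiplicative (ℤ × ℤ))) *
        (MulEquiv.inv (Multiplicative (ℤ × ℤ))) = (1 : MulAut _) := by
      refine MulEquiv.ext fun x => ?_
      exact inv_inv x
    rcases h (Multiplicative.toAdd a) with ha | ha <;>
      rcases h (Multiplicative.toAdd b) with hb | hb <;>
      simp [toAdd_mul, ha, hb, h11, hinv]

theorem negPhi_ne_one (g : Multiplicative (ZMod 2)) (hg : g ≠ 1)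
    (n : Multiplicative (ℤ × ℤ)) : negPhi g n = n⁻¹ := by
  have h0 : ¬ (Multiplicative.toAdd g = 0) := fun h => hg h
  change (if Multiplicative.toAdd g = 0 then (1 : MulAut (Multiplicative (ℤ × ℤ)))
    else MulEquiv.inv (Multiplicative (ℤ × ℤ))) n = n⁻¹
  rw [if_neg h0]
  rfl

/-- Reduction mod 2 on the lattice. -/
def redL : Multiplicative (ℤ × ℤ) →* Multiplicative (ZMod 2 × ZMod 2 × ZMod 2) :=
  AddMonoidHom.toMultiplicative
    { toFun := fun x => ((x.1 : ZMod 2), (x.2 : ZMod 2), 0)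
      map_zero' := by simp
      map_add' := by intro x y; simp }

/-- Inclusion of the last factor. -/
def redR : Multiplicative (ZMod 2) →* Multiplicative (ZMod 2 × ZMod 2 × ZMod 2) :=
  AddMonoidHom.toMultiplicative
    { toFun := fun x => (0, 0, x)
      map_zero' := by simp
      map_add' := by intro x y; simp }

theorem sq_one : ∀ y : Multiplicative (ZMod 2 × ZMod 2 × ZMod 2), y⁻¹ = y := by decide

/-- The reduction homomorphism from the semidirect product. -/
def redHom : SemidirectProduct (Multiplicative (ℤ × ℤ)) (Multiplicative (ZMod 2)) negPhi →*
    Multiplicative (ZMod 2 × ZMod 2 × ZMod 2) :=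
  SemidirectProduct.lift redL redR (by
    intro g
    refine MonoidHom.ext fun n => ?_
    change redL (negPhi g n) = redR g * redL n * (redR g)⁻¹
    rw [mul_comm (redR g), mul_inv_cancel_right]
    by_cases hg : g = 1
    · subst hg; simp
    · rw [negPhi_ne_one g hg, map_inv, sq_one])

theorem redHom_apply (x : SemidirectProduct (Multiplicative (ℤ × ℤ))
    (Multiplicative (ZMod 2)) negPhi) :
    redHom x = Multiplicative.ofAdd (((Multiplicative.toAdd x.left).1 : ZMod 2),
      ((Multiplicative.toAdd x.left).2 : ZMod 2), Multiplicative.toAdd x.right) := by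
  change redL x.left * redR x.right = _
  apply Multiplicative.toAdd.injective
  simp [redL, redR]

theorem of_inl_sq (m : Multiplicative (ℤ × ℤ)) :
    Abelianization.of (SemidirectProduct.inl (φ := negPhi) (m * m)) = 1 := by
  have h := congrArg Abelianization.of
    (SemidirectProduct.inl_aut (φ := negPhi) (Multiplicative.ofAdd 1) m)
  rw [negPhi_ne_one _ (by decide)] at h
  simp only [map_mul, map_inv] at h
  rw [mul_comm (Abelianization.of (SemidirectProduct.inr _)), mul_inv_cancel_right] at h
  rw [map_mul, map_mul]
  nth_rewrite 1 [← h]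
  exact inv_mul_cancel _

/-- Let `C₂ = ℤ/2ℤ` act on `ℤ² = ℤ × ℤ` by letting the nontrivial element act by
negation.  Then the abelianization of the semidirect product `ℤ² ⋊ C₂` is
isomorphic to `(ℤ/2ℤ)³`. -/
theorem stmt_13 :
    (∀ g : Multiplicative (ZMod 2), g ≠ 1 →
      ∀ n : Multiplicative (ℤ × ℤ), negPhi g n = n⁻¹) ∧
    Nonempty
      (Abelianization
          (SemidirectProduct (Multiplicative (ℤ × ℤ)) (Multiplicative (ZMod 2)) negPhi)
        ≃* Multiplicative (ZMod 2 × ZMod 2 × ZMod 2)) := by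
  refine ⟨negPhi_ne_one, ⟨MulEquiv.ofBijective (Abelianization.lift redHom) ⟨?_, ?_⟩⟩⟩
  · rw [injective_iff_map_eq_one]
    intro a ha
    obtain ⟨x, rfl⟩ := QuotientGroup.mk_surjective a
    change redHom x = 1 at ha
    change Abelianization.of x = 1
    rw [redHom_apply] at ha
    have ha' := congrArg Multiplicative.toAdd ha
    simp only [toAdd_ofAdd, toAdd_one, Prod.mk_eq_zero] at ha'
    obtain ⟨h1, h2, h3⟩ := ha'
    rw [ZMod.intCast_zmod_eq_zero_iff_dvd _ 2] at h1 h2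
    obtain ⟨p, hp⟩ := h1
    obtain ⟨q, hq⟩ := h2
    have hx : x = SemidirectProduct.inl (Multiplicative.ofAdd (p, q) *
        Multiplicative.ofAdd (p, q)) := by
      apply SemidirectProduct.ext
      · apply Multiplicative.toAdd.injective
        apply Prod.ext
        · simpa [two_mul] using hp
        · simpa [two_mul] using hq
      · exact h3
    rw [hx]
    exact of_inl_sq _
  · intro y
    refine ⟨Abelianization.of ⟨Multiplicative.ofAdd
      (((Multiplicative.toAdd y).1.val : ℤ), ((Multiplicative.toAdd y).2.1.val : ℤ)),
      Multiplicative.ofAdd (Multiplicative.toAdd y).2.2⟩, ?_⟩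
    rw [Abelianization.lift_apply_of, redHom_apply]
    apply Multiplicative.toAdd.injective
    simp
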